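/- arXiv:2211.00464 — 5 statements merged into one kernel-verified Lean document; each statement's English description precedes it below -/
import Mathlib

section
/- Let G=(V,E) be a hypergraph with complex activities (λ_v)_{v∈V}, and let A ⊆ V be a nonempty set such that no edge e ∈ E satisfies e ⊆ A. Then Z_{G+A}(λ) = Z_G(λ) − (Π_{x∈A} λ_x) · Z_{G/A}(λ), where: G+A is the hypergraph (V, E ∪ {A}); C(A) = {u ∈ V∖A : there exists e ∈ E with e∖A = {u}}; E/A = {e ∈ E : e ∩ A = ∅} ∪ {e∖A : e ∈ E, e ∩ A ≠ ∅, |e∖A| ≥ 2}; and Z_{G/A}(λ) = Σ over subsets I of V∖(A∪C(A)) that contain no member of E/A, of Π_{u∈I} λ_u. -/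
open Finset

/-- The multivariate independence polynomial of the hypergraph with vertex set `W`
(a finset of the ambient type `V`) and edge family `F`, with activities `lam`:
the sum over all subsets `I ⊆ W` containing no member of `F` of `∏_{u ∈ I} lam u`. -/
noncomputable def multiIndepPolyOn {V : Type*} [DecidableEq V]
    (W : Finset V) (F : Finset (Finset V)) (lam : V → ℂ) : ℂ :=
  ∑ I ∈ W.powerset.filter (fun I => ∀ e ∈ F, ¬ e ⊆ I), ∏ u ∈ I, lam u

/-- For `J` disjoint from `A`, the set `A ∪ J` is independent in `E` iff `J` avoids `C(A)` and is
independent in the contraction `E/A`. -/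
theorem forall_not_subset_union_iff_contraction {V : Type*} [Fintype V] [DecidableEq V]
    (E : Finset (Finset V)) (A : Finset V) (hnotin : ∀ e ∈ E, ¬ e ⊆ A)
    (J : Finset V) (hJ : Disjoint A J) :
    (∀ e ∈ E, ¬ e ⊆ A ∪ J) ↔
      J ⊆ univ \ (A ∪ ((univ \ A).filter (fun u => ∃ e ∈ E, e \ A = {u}))) ∧
        ∀ e ∈ (E.filter (fun e => e ∩ A = ∅)) ∪
          ((E.filter (fun e => (e ∩ A).Nonempty ∧ 2 ≤ (e \ A).card)).image
            (fun e => e \ A)), ¬ e ⊆ J := by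
  have key : ∀ e : Finset V, e ⊆ A ∪ J ↔ e \ A ⊆ J := fun e => sdiff_le_iff.symm
  constructor
  · intro h
    refine ⟨fun u hu => ?_, fun e he heJ => ?_⟩
    · have huA : u ∉ A := fun hA => disjoint_left.mp hJ hA hu
      simp only [mem_sdiff, mem_univ, true_and, mem_union, mem_filter, not_or]
      refine ⟨huA, ?_⟩
      rintro ⟨-, e, he, heu⟩
      exact h e he ((key e).2 (by simpa [heu] using hu))
    · simp only [mem_union, mem_filter, mem_image] at he
      rcases he with ⟨he, -⟩ | ⟨f, ⟨hf, -⟩, rfl⟩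
      · exact h e he (heJ.trans subset_union_right)
      · exact h f hf ((key f).2 heJ)
  · rintro ⟨hC, hF⟩ e he heJ
    have hsub := (key e).1 heJ
    have hne : (e \ A).Nonempty := sdiff_nonempty.2 (hnotin e he)
    rcases (Nat.succ_le_of_lt hne.card_pos).eq_or_lt with h1 | h2
    · obtain ⟨u, hu⟩ := card_eq_one.1 h1.symm
      have huJ : u ∈ J := hsub (by simp [hu])
      have huC := hC huJ
      simp only [mem_sdiff, mem_univ, true_and, mem_union, mem_filter, not_or] at huC
      exact huC.2 ⟨huC.1, e, he, hu⟩
    · by_cases hd : e ∩ A = ∅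
      · refine hF e (mem_union_left _ (mem_filter.2 ⟨he, hd⟩)) ?_
        rwa [sdiff_eq_self_of_disjoint (disjoint_iff_inter_eq_empty.2 hd)] at hsub
      · exact hF (e \ A) (mem_union_right _ (mem_image_of_mem _
          (mem_filter.2 ⟨he, nonempty_iff_ne_empty.2 hd, h2⟩))) hsub

/-- Deletion–contraction identity for adding an edge `A`:
if `A ⊆ V` is nonempty and no edge `e ∈ E` satisfies `e ⊆ A`, then
`Z_{G+A}(λ) = Z_G(λ) − (∏_{x∈A} λ_x) · Z_{G/A}(λ)`, where
`G + A = (V, E ∪ {A})`,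
`C(A) = {u ∈ V \ A : ∃ e ∈ E, e \ A = {u}}`,
`E/A = {e ∈ E : e ∩ A = ∅} ∪ {e \ A : e ∈ E, e ∩ A ≠ ∅, |e \ A| ≥ 2}`, and
`Z_{G/A}` is the independence polynomial on vertex set `V \ (A ∪ C(A))`
with edge family `E/A`. -/
theorem edge_addition_contraction
    {V : Type*} [Fintype V] [DecidableEq V]
    (E : Finset (Finset V))
    (hEdgeSize : ∀ e ∈ E, 2 ≤ e.card)
    (lam : V → ℂ)
    (A : Finset V) (hA : A.Nonempty)
    (hnotin : ∀ e ∈ E, ¬ e ⊆ A) :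
    multiIndepPolyOn univ (insert A E) lam =
      multiIndepPolyOn univ E lam -
      (∏ x ∈ A, lam x) *
        multiIndepPolyOn
          (univ \ (A ∪ ((univ \ A).filter (fun u => ∃ e ∈ E, e \ A = {u}))))
          ((E.filter (fun e => e ∩ A = ∅)) ∪
            ((E.filter (fun e => (e ∩ A).Nonempty ∧ 2 ≤ (e \ A).card)).image
              (fun e => e \ A)))
          lam := by
  unfold multiIndepPolyOn
  rw [eq_sub_iff_add_eq, eq_comm]
  refine (sum_filter_not_add_sum_filter _ (fun I => A ⊆ I) _).symm.trans ?_
  congr 1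
  · refine sum_congr ?_ fun _ _ => rfl
    ext I
    simp [and_comm]
  · rw [mul_sum]
    refine (sum_bij' (fun J _ => A ∪ J) (fun I _ => I \ A) ?_ ?_ ?_ ?_ ?_).symm
    · intro J hJ
      simp only [mem_filter, mem_powerset] at hJ
      have hd : Disjoint A J := disjoint_left.2 fun x hx hxJ =>
        (mem_sdiff.1 (hJ.1 hxJ)).2 (mem_union_left _ hx)
      simp only [mem_filter, mem_powerset]
      exact ⟨⟨subset_univ _,
        (forall_not_subset_union_iff_contraction E A hnotin J hd).2 hJ⟩, subset_union_left⟩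
    · intro I hI
      simp only [mem_filter] at hI
      simp only [mem_filter, mem_powerset]
      refine (forall_not_subset_union_iff_contraction E A hnotin _ disjoint_sdiff).1 ?_
      rw [union_sdiff_of_subset hI.2]
      exact hI.1.2
    · intro J hJ
      simp only [mem_filter, mem_powerset] at hJ
      have hd : Disjoint A J := disjoint_left.2 fun x hx hxJ =>
        (mem_sdiff.1 (hJ.1 hxJ)).2 (mem_union_left _ hx)
      exact union_sdiff_cancel_left hd
    · intro I hI
      simp only [mem_filter] at hI
      exact union_sdiff_of_subset hI.2
    · intro J hJ
      simp only [mem_filter, mem_powerset] at hJ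
      have hd : Disjoint A J := disjoint_left.2 fun x hx hxJ =>
        (mem_sdiff.1 (hJ.1 hxJ)).2 (mem_union_left _ hx)
      exact (prod_union hd).symm
end

section
/- For all integers Δ ≥ 2 and k ≥ 2, the inequality (log 2)/(2k) · Δ^(−1/(k−1)) ≤ ((Δ−1)/Δ)^(Δ−1) · (1 − Δ^(−1/(k−1))) · Δ^(−1/(k−1)) holds; equivalently, (log 2)/(2k) ≤ ((Δ−1)/Δ)^(Δ−1) · (1 − Δ^(−1/(k−1))). -/
/-- Lower bound `log x / (m + log x) ≤ 1 - x^(-1/m)`, from `1 + t ≤ exp t`. -/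
lemma log_div_add_log_le_one_sub_rpow {x m : ℝ} (hx : 1 ≤ x) (hm : 0 < m) :
    Real.log x / (m + Real.log x) ≤ 1 - x ^ (-(1 / m)) := by
  have hlog : 0 ≤ Real.log x := Real.log_nonneg hx
  have hpow : x ^ (-(1 / m)) = (Real.exp (Real.log x / m))⁻¹ := by
    rw [Real.rpow_def_of_pos (by linarith), ← Real.exp_neg]
    congr 1
    ring
  have hexp : (m + Real.log x) / m ≤ Real.exp (Real.log x / m) := by
    have h := Real.add_one_le_exp (Real.log x / m)
    rwa [add_div, div_self hm.ne', add_comm]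
  have hinv := inv_anti₀ (by positivity) hexp
  rw [inv_div] at hinv
  have hsplit : Real.log x / (m + Real.log x) = 1 - m / (m + Real.log x) := by
    have : m + Real.log x ≠ 0 := by positivity
    field_simp
    ring
  rw [hpow, hsplit]
  linarith

/-- `(1 - 1/n)^(n - 1)` is at least `1/e`. -/
lemma exp_neg_one_le_sub_one_div_pow {n : ℕ} (hn : 2 ≤ n) :
    Real.exp (-1) ≤ (((n : ℝ) - 1) / n) ^ (n - 1) := by
  obtain ⟨d, rfl⟩ := Nat.exists_eq_add_of_le' (show 1 ≤ n by omega)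
  have hd : (0 : ℝ) < d := by exact_mod_cast (show 0 < d by omega)
  have hbase : Real.exp (-(1 / (d : ℝ))) ≤ d / (d + 1) := by
    rw [Real.exp_neg, ← inv_div ((d : ℝ) + 1) d]
    refine inv_anti₀ (by positivity) ?_
    rw [add_div, div_self hd.ne', add_comm]
    exact Real.add_one_le_exp _
  calc Real.exp (-1) = Real.exp (-(1 / (d : ℝ))) ^ d := by
        rw [← Real.exp_nat_mul]
        congr 1
        field_simp
    _ ≤ ((d : ℝ) / (d + 1)) ^ d := by gcongr
    _ = _ := by simp

lemma log_two_div_two_le_exp_neg_one : Real.log 2 / 2 ≤ Real.exp (-1) := by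
  rw [Real.exp_neg, ← one_div, le_div_iff₀ (Real.exp_pos 1)]
  nlinarith [Real.log_two_lt_d9, Real.exp_one_lt_d9, Real.exp_pos 1]

/-- The inequality without the common factor, via `1 - x^(-1/m) ≥ log x / (m + log x)`. -/
lemma log_two_div_le_pow_mul_one_sub_rpow {n : ℕ} (hn : 2 ≤ n) {m : ℝ} (hm : 0 < m) :
    Real.log 2 / (2 * (m + 1)) ≤
      (((n : ℝ) - 1) / n) ^ (n - 1) * (1 - (n : ℝ) ^ (-(1 / m))) := by
  have hn' : (2 : ℝ) ≤ n := by exact_mod_cast hn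
  have hbound := log_div_add_log_le_one_sub_rpow (by linarith : (1 : ℝ) ≤ n) hm
  have hc : 0 ≤ (((n : ℝ) - 1) / n) ^ (n - 1) :=
    pow_nonneg (div_nonneg (by linarith) (by linarith)) _
  refine le_trans ?_ (mul_le_mul_of_nonneg_left hbound hc)
  rcases hn.eq_or_lt with rfl | hn3
  · have hL := Real.log_pos one_lt_two
    have hL1 : Real.log 2 ≤ 1 := by linarith [Real.log_two_lt_d9]
    calc Real.log 2 / (2 * (m + 1)) = 1 / 2 * (Real.log 2 / (m + 1)) := by
          field_simp
      _ ≤ 1 / 2 * (Real.log 2 / (m + Real.log 2)) := by gcongr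
      _ = _ := by norm_num
  · have hn3' : (3 : ℝ) ≤ n := by exact_mod_cast hn3
    have hD : 1 ≤ Real.log n := by
      rw [Real.le_log_iff_exp_le (by linarith)]
      linarith [Real.exp_one_lt_d9]
    have hfrac : 1 / (m + 1) ≤ Real.log n / (m + Real.log n) := by
      rw [div_le_div_iff₀ (by positivity) (by positivity)]
      nlinarith
    calc Real.log 2 / (2 * (m + 1)) = Real.log 2 / 2 * (1 / (m + 1)) := by
          field_simp
      _ ≤ _ := mul_le_mul
          (log_two_div_two_le_exp_neg_one.trans (exp_neg_one_le_sub_one_div_pow hn))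
          hfrac (by positivity) hc

/-- For integers `Δ ≥ 2`, `k ≥ 2`:
`(log 2)/(2k) · Δ^(−1/(k−1)) ≤ ((Δ−1)/Δ)^(Δ−1) · (1 − Δ^(−1/(k−1))) · Δ^(−1/(k−1))`;
equivalently `(log 2)/(2k) ≤ ((Δ−1)/Δ)^(Δ−1) · (1 − Δ^(−1/(k−1)))`. -/
theorem log_two_bound_le_tree_bound
    (Δ k : ℕ) (hΔ : 2 ≤ Δ) (hk : 2 ≤ k) :
    (Real.log 2 / (2 * (k : ℝ)) * (Δ : ℝ) ^ (-(1 / ((k : ℝ) - 1))) ≤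
      (((Δ : ℝ) - 1) / (Δ : ℝ)) ^ (Δ - 1) *
        (1 - (Δ : ℝ) ^ (-(1 / ((k : ℝ) - 1)))) * (Δ : ℝ) ^ (-(1 / ((k : ℝ) - 1)))) ∧
    (Real.log 2 / (2 * (k : ℝ)) ≤
      (((Δ : ℝ) - 1) / (Δ : ℝ)) ^ (Δ - 1) *
        (1 - (Δ : ℝ) ^ (-(1 / ((k : ℝ) - 1))))) := by
  have hk' : (2 : ℝ) ≤ k := by exact_mod_cast hk
  have hmain := log_two_div_le_pow_mul_one_sub_rpow hΔ (by linarith : (0 : ℝ) < (k : ℝ) - 1)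
  rw [sub_add_cancel] at hmain
  exact ⟨mul_le_mul_of_nonneg_right hmain (by positivity), hmain⟩
end

section
/- For every odd integer k ≥ 3 there exists s₀ such that for every integer s ≥ s₀ the following holds: setting Δ = (k−1)s, there exists a k-uniform hypergraph G of maximum degree Δ and a real number λ with −k·(log Δ)/Δ < λ < 0 such that Z_G(λ) = 0. In particular, for each odd k ≥ 3 there is a family of k-uniform hypergraphs of maximum degree Δ whose smallest root λ satisfies |λ| = O((log Δ)/Δ). -/
open Finset

/-- The (real) univariate independence polynomial of the hypergraph with vertex
type `V` and edge set `E`: the sum of `x ^ |I|` over all independent sets `I`. -/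
noncomputable def indepPolyR {V : Type*} [Fintype V] [DecidableEq V]
    (E : Finset (Finset V)) (x : ℝ) : ℝ :=
  ∑ I ∈ univ.powerset.filter (fun I => ∀ e ∈ E, ¬ e ⊆ I), x ^ I.card

section Transfer

variable {V W : Type*} [DecidableEq V] [DecidableEq W]

/-- The independence polynomial is invariant under relabelling the vertices. -/
theorem indepPolyR_map_equiv [Fintype V] [Fintype W] (f : V ≃ W) (E : Finset (Finset V)) (x : ℝ) :
    indepPolyR (E.map f.finsetCongr.toEmbedding) x = indepPolyR E x := by
  unfold indepPolyR
  symm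
  refine Finset.sum_equiv f.finsetCongr ?_ ?_
  · intro I
    simp only [mem_filter, powerset_univ, mem_univ, true_and, forall_mem_map,
      Equiv.coe_toEmbedding, Equiv.finsetCongr_apply, map_subset_map]
  · intro I _
    simp

/-- Relabelling the vertices does not change degrees. -/
theorem card_filter_mem_map_equiv (f : V ≃ W) (E : Finset (Finset V)) (w : W) :
    ((E.map f.finsetCongr.toEmbedding).filter (fun e => w ∈ e)).card =
      (E.filter (fun e => f.symm w ∈ e)).card := by
  rw [Finset.filter_map, Finset.card_map]
  congr 1
  ext e
  simp

end Transfer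

/-- A core of `k` vertices together with `k` groups of `s` pendant vertices; each pendant vertex
of the `i`-th group forms an edge with the core minus its `i`-th vertex. -/
def coreEdges (k s : ℕ) : Finset (Finset (Fin k ⊕ Fin k × Fin s)) :=
  univ.image fun p : Fin k × Fin s => (univ.erase p.1).disjSum {p}

theorem card_of_mem_coreEdges {k s : ℕ} {e : Finset (Fin k ⊕ Fin k × Fin s)}
    (he : e ∈ coreEdges k s) : e.card = k := by
  simp only [coreEdges, mem_image, mem_univ, true_and] at he
  obtain ⟨p, rfl⟩ := he
  have := p.1.pos
  rw [card_disjSum, card_erase_of_mem (mem_univ _), card_univ, Fintype.card_fin, card_singleton]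
  omega

theorem degree_coreEdges_le {k s : ℕ} (hk : 2 ≤ k) (v : Fin k ⊕ Fin k × Fin s) :
    ((coreEdges k s).filter (fun e => v ∈ e)).card ≤ (k - 1) * s := by
  rw [coreEdges, filter_image]
  refine card_image_le.trans ?_
  rcases v with j | q
  · have : (univ.filter fun p : Fin k × Fin s =>
        Sum.inl j ∈ (univ.erase p.1).disjSum {p}) = (univ.erase j) ×ˢ univ := by
      ext p
      simp [eq_comm]
    rw [this, card_product]
    simp
  · have : (univ.filter fun p : Fin k × Fin s =>
        Sum.inr q ∈ (univ.erase p.1).disjSum {p}) = {q} := by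
      ext p
      simp [eq_comm]
    rw [this, card_singleton]
    exact Nat.mul_pos (by omega) q.2.pos

theorem card_filter_not_erase_subset {k : ℕ} (J : Finset (Fin k)) :
    (univ.filter fun i : Fin k => ¬ univ.erase i ⊆ J).card =
      if J.card = k then 0 else if J.card = k - 1 then k - 1 else k := by
  have key : ∀ i : Fin k, univ.erase i ⊆ J ↔ Jᶜ ⊆ {i} := by
    intro i
    simp only [subset_iff, mem_erase, mem_univ, mem_compl, mem_singleton]
    exact forall_congr' fun a => by tauto
  simp only [key]
  have hc : Jᶜ.card = k - J.card := by simp [card_compl]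
  have hJ : J.card ≤ k := by simpa using card_le_univ J
  split_ifs with h1 h2
  · have : Jᶜ = ∅ := by rw [← card_eq_zero]; omega
    simp [this]
  · obtain ⟨a, ha⟩ := card_eq_one.mp (show Jᶜ.card = 1 by omega)
    have : (univ.filter fun i : Fin k => ¬ ({a} : Finset (Fin k)) ⊆ {i}) = univ.erase a := by
      ext i
      simp [eq_comm]
    rw [ha, this]
    simp
  · rw [filter_true_of_mem, card_univ, Fintype.card_fin]
    intro i _ h
    have := card_le_card h
    rw [card_singleton] at this
    omega

theorem indepPolyR_coreEdges_eq_sum (k s : ℕ) (x : ℝ) :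
    indepPolyR (coreEdges k s) x =
      ∑ J : Finset (Fin k), x ^ J.card *
        (1 + x) ^ ((univ.filter fun i : Fin k => ¬ univ.erase i ⊆ J).card * s) := by
  have inner : ∀ J : Finset (Fin k),
      (1 + x) ^ ((univ.filter fun i : Fin k => ¬ univ.erase i ⊆ J).card * s) =
      ∑ P ∈ ((univ.filter fun i : Fin k => ¬ univ.erase i ⊆ J) ×ˢ
        (univ : Finset (Fin s))).powerset, x ^ P.card := by
    intro J
    have := Finset.sum_pow_mul_eq_add_pow x 1 ((univ.filter fun i : Fin k =>
      ¬ univ.erase i ⊆ J) ×ˢ (univ : Finset (Fin s)))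
    simp only [one_pow, mul_one, card_product, card_univ, Fintype.card_fin] at this
    rw [this, add_comm]
  simp only [inner, mul_sum, sum_sigma']
  unfold indepPolyR
  refine Finset.sum_bij' (fun I _ => ⟨I.toLeft, I.toRight⟩) (fun p _ => p.1.disjSum p.2)
    ?_ ?_ ?_ ?_ ?_
  · intro I hI
    simp only [coreEdges, mem_filter, mem_image, mem_univ, true_and, powerset_univ,
      forall_exists_index, forall_apply_eq_imp_iff] at hI
    simp only [mem_sigma, mem_univ, true_and, mem_powerset]
    intro p hp
    simp only [mem_product, mem_filter, mem_univ, true_and, and_true]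
    intro h
    refine hI p fun v hv => ?_
    rcases v with j | q
    · exact mem_toLeft.mp (h (by simpa using hv))
    · have hq : q = p := by simpa using hv
      exact hq ▸ mem_toRight.mp hp
  · rintro ⟨J, P⟩ h
    simp only [mem_sigma, mem_univ, true_and, mem_powerset] at h
    simp only [coreEdges, mem_filter, mem_image, mem_univ, true_and, powerset_univ,
      forall_exists_index, forall_apply_eq_imp_iff]
    intro p hp
    have hpP : p ∈ P := by
      have : Sum.inr p ∈ J.disjSum P := hp (by simp)
      simpa using this
    have := h hpP
    simp only [mem_product, mem_filter, mem_univ, true_and, and_true] at this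
    refine this fun j hj => ?_
    have : Sum.inl j ∈ J.disjSum P := hp (by simpa using hj)
    simpa using this
  · intro I _
    exact toLeft_disjSum_toRight
  · rintro ⟨J, P⟩ _
    simp
  · intro I _
    rw [← pow_add, card_toLeft_add_card_toRight]

theorem indepPolyR_coreEdges {k : ℕ} (hk : 1 ≤ k) (s : ℕ) (x : ℝ) :
    indepPolyR (coreEdges k s) x =
      (1 + x) ^ (k * s) * ((1 + x) ^ k - k * x ^ (k - 1) - x ^ k) +
        k * x ^ (k - 1) * (1 + x) ^ ((k - 1) * s) + x ^ k := by
  obtain ⟨m, rfl⟩ := Nat.exists_eq_add_of_le' hk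
  rw [indepPolyR_coreEdges_eq_sum]
  simp only [card_filter_not_erase_subset]
  rw [← powerset_univ, Finset.sum_powerset_apply_card (fun c => x ^ c * (1 + x) ^
    ((if c = m + 1 then 0 else if c = m + 1 - 1 then m + 1 - 1 else m + 1) * s))]
  rw [add_comm 1 x, add_pow x 1 (m + 1)]
  simp only [card_univ, Fintype.card_fin, one_pow, mul_one, sum_range_succ _ (m + 1),
    sum_range_succ _ m, nsmul_eq_mul]
  have h : ∀ c ∈ range m, ((m + 1).choose c : ℝ) * (x ^ c * (x + 1) ^
      ((if c = m + 1 then 0 else if c = m + 1 - 1 then m + 1 - 1 else m + 1) * s)) =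
      (x + 1) ^ ((m + 1) * s) * (x ^ c * ((m + 1).choose c : ℝ)) := by
    intro c hc
    have := mem_range.mp hc
    rw [if_neg (by omega), if_neg (by omega)]
    ring
  rw [sum_congr rfl h, ← mul_sum]
  simp
  ring

theorem continuous_indepPolyR {V : Type*} [Fintype V] [DecidableEq V] (E : Finset (Finset V)) :
    Continuous (indepPolyR E) := by
  unfold indepPolyR
  fun_prop

theorem indepPolyR_coreEdges_neg {k s : ℕ} (hk : 3 ≤ k) (hodd : Odd k)
    (hlog : 2 ≤ Real.log (((k - 1) * s : ℕ) : ℝ))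
    (hle : k * Real.log (((k - 1) * s : ℕ) : ℝ) ≤ (((k - 1) * s : ℕ) : ℝ)) :
    indepPolyR (coreEdges k s)
      (-(k : ℝ) * Real.log (((k - 1) * s : ℕ) : ℝ) / (((k - 1) * s : ℕ) : ℝ)) < 0 := by
  rw [indepPolyR_coreEdges (by omega)]
  have hks : k * s = (k - 1) * s + s := by
    obtain ⟨m, rfl⟩ := Nat.exists_eq_add_of_le' (show 1 ≤ k by omega)
    simp; ring
  set N := (k - 1) * s
  set L := Real.log (N : ℝ) with hL
  have hk' : (3 : ℝ) ≤ k := by exact_mod_cast hk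
  have hN : (0 : ℝ) < N := by nlinarith
  set y := k * L / (N : ℝ) with hy
  have hy0 : 0 < y := by positivity
  have hy1 : y ≤ 1 := (div_le_one hN).mpr hle
  have hx : -(k : ℝ) * L / (N : ℝ) = -y := by rw [hy]; ring
  have heven : Even (k - 1) := by
    obtain ⟨m, rfl⟩ := hodd
    simp
  rw [hx, hodd.neg_pow, heven.neg_pow, ← sub_eq_add_neg 1 y]
  have hA : (1 - y) ^ N ≤ 1 / (N : ℝ) ^ k := by
    calc (1 - y) ^ N ≤ Real.exp (-y) ^ N :=
          pow_le_pow_left₀ (by linarith) (Real.one_sub_le_exp_neg y) N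
      _ = Real.exp (-L) ^ k := by
          rw [← Real.exp_nat_mul, ← Real.exp_nat_mul]
          congr 1
          rw [hy]; field_simp
      _ = 1 / (N : ℝ) ^ k := by
          rw [Real.exp_neg, hL, Real.exp_log hN, inv_pow, one_div]
  have hA0 : 0 ≤ (1 - y) ^ N := pow_nonneg (by linarith) N
  have hB0 : 0 ≤ (1 - y) ^ (k * s) := pow_nonneg (by linarith) _
  have hB : (1 - y) ^ (k * s) ≤ (1 - y) ^ N :=
    pow_le_pow_of_le_one (by linarith) (by linarith) (by omega)
  have hyk : y ^ k ≤ 1 := pow_le_one₀ hy0.le hy1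
  have hyk' : y ^ (k - 1) ≤ 1 := pow_le_one₀ hy0.le hy1
  have hyk0 : 0 ≤ y ^ (k - 1) := by positivity
  have h1k : (1 - y) ^ k ≤ 1 := pow_le_one₀ (by linarith) (by linarith)
  have hfirst : (1 - y) ^ (k * s) * ((1 - y) ^ k - k * y ^ (k - 1) - -y ^ k) ≤
      (1 - y) ^ N * 2 := by
    have : (1 - y) ^ k - k * y ^ (k - 1) - -y ^ k ≤ 2 := by
      have : 0 ≤ (k : ℝ) * y ^ (k - 1) := by positivity
      linarith
    nlinarith
  have hsecond : k * y ^ (k - 1) * (1 - y) ^ N ≤ k * (1 - y) ^ N := by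
    refine mul_le_mul_of_nonneg_right ?_ hA0
    nlinarith
  have hthird : y ^ k = (k * L) ^ k * (1 / (N : ℝ) ^ k) := by
    rw [hy, div_pow]; ring
  have hbig : 2 + (k : ℝ) < (k * L) ^ k := by
    have h6 : 2 + (k : ℝ) < k * L := by nlinarith
    exact h6.trans_le (le_self_pow₀ (by linarith) (by omega))
  have hpos : 0 < 1 / (N : ℝ) ^ k := by positivity
  have : (2 + (k : ℝ)) * (1 - y) ^ N < y ^ k := by
    rw [hthird]
    calc (2 + (k : ℝ)) * (1 - y) ^ N ≤ (2 + (k : ℝ)) * (1 / (N : ℝ) ^ k) := by gcongr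
      _ < _ := by gcongr
  linarith

theorem exists_two_le_log_and_mul_log_le (k : ℕ) (hk : 3 ≤ k) :
    ∃ s₀ : ℕ, ∀ s : ℕ, s₀ ≤ s → 2 ≤ Real.log (((k - 1) * s : ℕ) : ℝ) ∧
      k * Real.log (((k - 1) * s : ℕ) : ℝ) ≤ (((k - 1) * s : ℕ) : ℝ) := by
  have hlim : Filter.Tendsto (fun s : ℕ => (((k - 1) * s : ℕ) : ℝ)) Filter.atTop Filter.atTop :=
    tendsto_natCast_atTop_atTop.comp
      (Filter.tendsto_id.const_mul_atTop' (show 0 < k - 1 by omega))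
  have h1 := (Real.tendsto_log_atTop.comp hlim).eventually_ge_atTop 2
  have h2 := hlim.eventually (Real.isLittleO_log_id_atTop.bound
    (show (0 : ℝ) < 1 / k by positivity))
  obtain ⟨s₀, hs₀⟩ := Filter.eventually_atTop.mp (h1.and h2)
  refine ⟨s₀, fun s hs => ?_⟩
  obtain ⟨ha, hb⟩ := hs₀ s hs
  refine ⟨ha, ?_⟩
  have hk0 : (0 : ℝ) < k := by positivity
  simp only [id, Real.norm_eq_abs, Nat.abs_cast] at hb
  have := (le_abs_self _).trans hb
  rwa [one_div, ← div_eq_inv_mul, le_div_iff₀ hk0, mul_comm] at this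


/-- For every odd `k ≥ 3` there is `s₀` such that for all `s ≥ s₀`, setting
`Δ = (k−1)s`, there is a `k`-uniform hypergraph of maximum degree `Δ` whose
independence polynomial has a zero `λ` with `−k·(log Δ)/Δ < λ < 0`. -/
theorem hypergraph_root_log_over_delta
    (k : ℕ) (hk : 3 ≤ k) (hodd : Odd k) :
    ∃ s₀ : ℕ, ∀ s : ℕ, s₀ ≤ s →
      ∃ (n : ℕ) (E : Finset (Finset (Fin n))),
        (∀ e ∈ E, e.card = k) ∧
        (∀ v : Fin n, (E.filter (fun e => v ∈ e)).card ≤ (k - 1) * s) ∧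
        ∃ lam : ℝ,
          -(k : ℝ) * Real.log (((k - 1) * s : ℕ) : ℝ) / (((k - 1) * s : ℕ) : ℝ) < lam ∧
          lam < 0 ∧ indepPolyR E lam = 0 := by
  obtain ⟨s₀, hs₀⟩ := exists_two_le_log_and_mul_log_le k hk
  refine ⟨s₀, fun s hs => ?_⟩
  obtain ⟨hlog, hle⟩ := hs₀ s hs
  let f := Fintype.equivFin (Fin k ⊕ Fin k × Fin s)
  refine ⟨_, (coreEdges k s).map f.finsetCongr.toEmbedding, ?_, ?_, ?_⟩
  · intro e he
    obtain ⟨e', he', rfl⟩ := mem_map.mp he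
    simpa using card_of_mem_coreEdges he'
  · intro v
    rw [card_filter_mem_map_equiv]
    exact degree_coreEdges_le (by omega) _
  · simp only [indepPolyR_map_equiv]
    have hneg := indepPolyR_coreEdges_neg hk hodd hlog hle
    have hzero : 0 < indepPolyR (coreEdges k s) 0 := by
      rw [indepPolyR_coreEdges (by omega)]
      simp [show k ≠ 0 by omega, show k - 1 ≠ 0 by omega]
    have hle0 : -(k : ℝ) * Real.log (((k - 1) * s : ℕ) : ℝ) / (((k - 1) * s : ℕ) : ℝ) ≤ 0 :=
      div_nonpos_of_nonpos_of_nonneg (by nlinarith [(Nat.cast_nonneg k : (0 : ℝ) ≤ k)])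
        (Nat.cast_nonneg _)
    obtain ⟨lam, ⟨h1, h2⟩, h3⟩ := intermediate_value_Ioo hle0
      (continuous_indepPolyR (coreEdges k s)).continuousOn ⟨hneg, hzero⟩
    exact ⟨lam, h1, h2, h3⟩
end

section
/- For every odd integer k ≥ 3 there exists s₀ such that for every integer s ≥ s₀, setting Δ = (k−1)s and x = −k·(log Δ)/Δ, one has Σ_{ℓ=0}^{k−2} binom(k,ℓ) · x^ℓ · (1+x)^{sk} + k · x^{k−1} · (1+x)^{s(k−1)} + x^k < 0. -/
open Finset

/-- If `D` is large enough that `2 ≤ log D` and `k * log D ≤ D`, then with `x = -k * log D / D` the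
term `x ^ k` dominates. -/
theorem sum_choose_mul_pow_add_neg {k m D : ℕ} (hk : 3 ≤ k) (hodd : Odd k) (hDm : D ≤ m)
    (hlog : 2 ≤ Real.log D) (hle : (k : ℝ) * Real.log D ≤ D) :
    (∑ l ∈ range (k - 1), (k.choose l : ℝ) * (-(k : ℝ) * Real.log D / D) ^ l *
        (1 + -(k : ℝ) * Real.log D / D) ^ m) +
      (k : ℝ) * (-(k : ℝ) * Real.log D / D) ^ (k - 1) * (1 + -(k : ℝ) * Real.log D / D) ^ D +
      (-(k : ℝ) * Real.log D / D) ^ k < 0 := by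
  have hk' : (3 : ℝ) ≤ k := by exact_mod_cast hk
  have hD : (0 : ℝ) < D := by nlinarith
  set x : ℝ := -(k : ℝ) * Real.log D / D with hx
  have hxD : D * x = -(k * Real.log D) := by rw [hx]; field_simp
  have hx0 : x ≤ 0 := by nlinarith
  have hx1 : 0 ≤ 1 + x := by nlinarith
  have habs : |x| ≤ 1 := by rw [abs_le]; constructor <;> linarith
  have hpow (l : ℕ) : x ^ l ≤ 1 :=
    (le_abs_self _).trans (by rw [abs_pow]; exact pow_le_one₀ (abs_nonneg _) habs)
  set P : ℝ := ((D : ℝ)⁻¹) ^ k with hP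
  have hP0 : 0 < P := by positivity
  have hDP : (1 + x) ^ D ≤ P := calc
    (1 + x) ^ D ≤ Real.exp x ^ D := by
      gcongr
      linarith [Real.add_one_le_exp x]
    _ = P := by
      rw [← Real.exp_nat_mul, hxD, ← mul_neg, Real.exp_nat_mul, Real.exp_neg, Real.exp_log hD]
  have hmP : (1 + x) ^ m ≤ P := (pow_le_pow_of_le_one hx1 (by linarith) hDm).trans hDP
  have hsum : ∑ l ∈ range (k - 1), (k.choose l : ℝ) * x ^ l * (1 + x) ^ m ≤ 2 ^ k * P := calc
    _ ≤ ∑ l ∈ range (k - 1), (k.choose l : ℝ) * P := by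
      refine sum_le_sum fun l _ => mul_le_mul ?_ hmP (pow_nonneg hx1 _) (by positivity)
      exact mul_le_of_le_one_right (by positivity) (hpow l)
    _ ≤ ∑ l ∈ range (k + 1), (k.choose l : ℝ) * P :=
      sum_le_sum_of_subset_of_nonneg (range_mono (by lia)) fun _ _ _ => by positivity
    _ = 2 ^ k * P := by
      rw [← sum_mul]
      exact_mod_cast congrArg (fun n : ℕ => (n : ℝ) * P) (Nat.sum_range_choose k)
  have hmid : (k : ℝ) * x ^ (k - 1) * (1 + x) ^ D ≤ k * P :=
    mul_le_mul (mul_le_of_le_one_right (by positivity) (hpow _)) hDP (pow_nonneg hx1 _)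
      (by positivity)
  have hxk : x ^ k = -((k * Real.log D) ^ k * P) := by
    rw [hP, ← mul_pow, ← hodd.neg_pow, hx]
    congr 1
    ring
  have hbig : (2 : ℝ) ^ k + k < (k * Real.log D) ^ k := calc
    (2 : ℝ) ^ k + k < 2 ^ k + 2 ^ k := by
      gcongr
      exact_mod_cast k.lt_two_pow_self
    _ = 2 * 2 ^ k := by ring
    _ ≤ k ^ k * 2 ^ k := by
      gcongr
      exact (by linarith : (2 : ℝ) ≤ k).trans (le_self_pow₀ (by linarith) (by lia))
    _ = (k * 2) ^ k := (mul_pow _ _ _).symm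
    _ ≤ (k * Real.log D) ^ k := by gcongr
  rw [hxk]
  nlinarith

/-- For every odd `k ≥ 3` there is `s₀` such that for all integers `s ≥ s₀`,
with `Δ = (k−1)s` and `x = −k·(log Δ)/Δ`,
`Σ_{ℓ=0}^{k−2} C(k,ℓ) x^ℓ (1+x)^{sk} + k x^{k−1} (1+x)^{s(k−1)} + x^k < 0`. -/
theorem samotij_construction_negative
    (k : ℕ) (hk : 3 ≤ k) (hodd : Odd k) :
    ∃ s₀ : ℕ, ∀ s : ℕ, s₀ ≤ s →
      (∑ l ∈ Finset.range (k - 1),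
          (k.choose l : ℝ) * (-(k : ℝ) * Real.log (((k - 1) * s : ℕ) : ℝ) /
              (((k - 1) * s : ℕ) : ℝ)) ^ l *
            (1 + -(k : ℝ) * Real.log (((k - 1) * s : ℕ) : ℝ) /
              (((k - 1) * s : ℕ) : ℝ)) ^ (s * k)) +
        (k : ℝ) * (-(k : ℝ) * Real.log (((k - 1) * s : ℕ) : ℝ) /
            (((k - 1) * s : ℕ) : ℝ)) ^ (k - 1) *
          (1 + -(k : ℝ) * Real.log (((k - 1) * s : ℕ) : ℝ) /
            (((k - 1) * s : ℕ) : ℝ)) ^ (s * (k - 1)) +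
        (-(k : ℝ) * Real.log (((k - 1) * s : ℕ) : ℝ) /
            (((k - 1) * s : ℕ) : ℝ)) ^ k < 0 := by
  have hlog := (Real.tendsto_log_atTop.comp tendsto_natCast_atTop_atTop).eventually_ge_atTop 2
  have hle := tendsto_natCast_atTop_atTop.eventually
    (Real.isLittleO_log_id_atTop.bound (c := (k : ℝ)⁻¹) (by positivity))
  obtain ⟨N, hN⟩ := Filter.eventually_atTop.1 (hlog.and hle)
  refine ⟨N, fun s hs => ?_⟩
  obtain ⟨h2, h3⟩ := hN ((k - 1) * s) (hs.trans (Nat.le_mul_of_pos_left s (by lia)))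
  rw [Function.comp_apply] at h2
  rw [mul_comm s (k - 1)]
  refine sum_choose_mul_pow_add_neg hk hodd ?_ h2 ?_
  · rw [mul_comm s k]
    exact Nat.mul_le_mul_right s (Nat.sub_le k 1)
  · rw [id, Real.norm_of_nonneg (by linarith), Real.norm_of_nonneg (Nat.cast_nonneg _)] at h3
    rwa [← le_inv_mul_iff₀ (by positivity)]
end

section
/- For every even integer k ≥ 4 there exists Δ₀ such that for all integers Δ ≥ Δ₀ the following holds: setting f = ((log Δ)/Δ)^{1/(k−1)} and λ = −f/(1+f), one has (1+λ)^{(k−1)Δ} + λ·((1+λ)^{k−1} − λ^{k−1})^Δ < 0. -/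
/-- For odd `n`, the star polynomial at `-f / (1 + f)` is negative once
`1 + f < f * (1 + f ^ n) ^ d`. -/
lemma star_polynomial_neg_of_lt {f : ℝ} {n d : ℕ} (hf : 0 < f) (hn : Odd n)
    (h : 1 + f < f * (1 + f ^ n) ^ d) :
    (1 + -(f / (1 + f))) ^ (n * d) +
      -(f / (1 + f)) * ((1 + -(f / (1 + f))) ^ n - (-(f / (1 + f))) ^ n) ^ d < 0 := by
  have h1 : 0 < 1 + f := by linarith
  have h2 : 1 + -(f / (1 + f)) = (1 + f)⁻¹ := by field_simp; ring
  have h3 : (1 + f)⁻¹ ^ n - (-(f / (1 + f))) ^ n = (1 + f)⁻¹ ^ n * (1 + f ^ n) := by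
    rw [hn.neg_pow, div_eq_mul_inv, mul_pow]; ring
  rw [h2, h3, mul_pow, ← pow_mul]
  have h4 : 1 < f / (1 + f) * (1 + f ^ n) ^ d := by
    rw [div_mul_eq_mul_div, lt_div_iff₀ h1]; linarith
  have h5 : 0 < (1 + f)⁻¹ ^ (n * d) := by positivity
  nlinarith

/-- The exponential satisfies `exp (x / 2) ≤ 1 + x` on the unit interval. -/
lemma exp_half_le_one_add {x : ℝ} (h0 : 0 ≤ x) (h1 : x ≤ 1) : Real.exp (x / 2) ≤ 1 + x := by
  refine (Real.exp_bound_div_one_sub_of_interval (by linarith) (by linarith)).trans ?_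
  rw [div_le_iff₀ (by linarith)]
  nlinarith


/-- For every even `k ≥ 4` there is `Δ₀` such that for all integers `Δ ≥ Δ₀`,
setting `f = ((log Δ)/Δ)^{1/(k−1)}` and `λ = −f/(1+f)`, the value of the
independence polynomial of the `k`-uniform star with `Δ` edges at `λ`,
namely `(1+λ)^{(k−1)Δ} + λ·((1+λ)^{k−1} − λ^{k−1})^Δ`, is negative. -/
theorem star_polynomial_negative
    (k : ℕ) (hk : 4 ≤ k) (heven : Even k) :
    ∃ Δ₀ : ℕ, ∀ Δ : ℕ, Δ₀ ≤ Δ →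
      (1 + -((Real.log Δ / (Δ : ℝ)) ^ ((1 : ℝ) / ((k : ℝ) - 1)) /
          (1 + (Real.log Δ / (Δ : ℝ)) ^ ((1 : ℝ) / ((k : ℝ) - 1))))) ^ ((k - 1) * Δ) +
        -((Real.log Δ / (Δ : ℝ)) ^ ((1 : ℝ) / ((k : ℝ) - 1)) /
          (1 + (Real.log Δ / (Δ : ℝ)) ^ ((1 : ℝ) / ((k : ℝ) - 1)))) *
          ((1 + -((Real.log Δ / (Δ : ℝ)) ^ ((1 : ℝ) / ((k : ℝ) - 1)) /
              (1 + (Real.log Δ / (Δ : ℝ)) ^ ((1 : ℝ) / ((k : ℝ) - 1))))) ^ (k - 1) -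
            (-((Real.log Δ / (Δ : ℝ)) ^ ((1 : ℝ) / ((k : ℝ) - 1)) /
              (1 + (Real.log Δ / (Δ : ℝ)) ^ ((1 : ℝ) / ((k : ℝ) - 1))))) ^ (k - 1)) ^ Δ
        < 0 := by
  refine ⟨100, fun d hd => ?_⟩
  have hd' : (100 : ℝ) ≤ d := by exact_mod_cast hd
  have hd0 : (0 : ℝ) < d := by linarith
  have hk' : (4 : ℝ) ≤ k := by exact_mod_cast hk
  have hL : 1 ≤ Real.log d := by
    rw [Real.le_log_iff_exp_le hd0]
    linarith [Real.exp_one_lt_d9]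
  have hx1 : Real.log d / d ≤ 1 := by
    rw [div_le_one hd0]
    exact Real.log_le_self hd0.le
  have hdx : (d : ℝ)⁻¹ ≤ Real.log d / d := by
    rw [inv_eq_one_div]
    gcongr
  have hx0 : 0 < Real.log d / d := by positivity
  set x := Real.log d / d with hx
  set f := x ^ ((1 : ℝ) / ((k : ℝ) - 1)) with hf
  have hf0 : 0 < f := by positivity
  have hf1 : f ≤ 1 := Real.rpow_le_one hx0.le hx1 (one_div_nonneg.2 (by linarith))
  have hfx : f ^ (k - 1) = x := by
    have hcast : ((k - 1 : ℕ) : ℝ) = k - 1 := by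
      rw [Nat.cast_sub (by omega)]; simp
    rw [hf, one_div, ← hcast]
    exact Real.rpow_inv_natCast_pow hx0.le (by omega)
  refine star_polynomial_neg_of_lt hf0 (Nat.Even.sub_odd (by omega) heven odd_one) ?_
  rw [hfx]
  have hpow : (d : ℝ) ^ (1 / 2 : ℝ) ≤ (1 + x) ^ d := by
    calc (d : ℝ) ^ (1 / 2 : ℝ) = Real.exp (x / 2) ^ d := by
          rw [Real.rpow_def_of_pos hd0, ← Real.exp_nat_mul, hx]
          congr 1
          field_simp
      _ ≤ (1 + x) ^ d := by
          gcongr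
          exact exp_half_le_one_add hx0.le hx1
  have hfd : (d : ℝ) ^ (-(1 / 3) : ℝ) ≤ f := by
    calc (d : ℝ) ^ (-(1 / 3) : ℝ) = (d : ℝ)⁻¹ ^ (1 / 3 : ℝ) := by
          rw [Real.rpow_neg hd0.le, Real.inv_rpow hd0.le]
      _ ≤ x ^ (1 / 3 : ℝ) := by gcongr
      _ ≤ f := Real.rpow_le_rpow_of_exponent_ge hx0 hx1
          (one_div_le_one_div_of_le (by norm_num) (by linarith))
  calc 1 + f ≤ 2 := by linarith
    _ = (64 : ℝ) ^ (1 / 6 : ℝ) := by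
        rw [show (64 : ℝ) = 2 ^ (6 : ℝ) by norm_num, ← Real.rpow_mul (by norm_num)]
        norm_num
    _ < (d : ℝ) ^ (1 / 6 : ℝ) :=
        Real.rpow_lt_rpow (by norm_num) (by linarith) (by norm_num)
    _ = (d : ℝ) ^ (-(1 / 3) : ℝ) * (d : ℝ) ^ (1 / 2 : ℝ) := by
        rw [← Real.rpow_add hd0]; norm_num
    _ ≤ f * (1 + x) ^ d := by gcongr
end
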